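/- Let $w \in RH_{\tilde s'}$ with $1 \le \tilde s < \infty$ and $v \in RH_{s_0'}(w)$ with $1 \le s_0 < \infty$, and let $0 < \alpha \le \beta < \infty$. Define $\mathcal{A}_w^\gamma F(x) = \big(\iint_{|x-y|<\gamma t} |F(y,t)|^2 \frac{dw(y)\,dt}{t\,w(B(y,t))}\big)^{1/2}$. Then $\|\mathcal{A}_w^\alpha F\|_{L^2(v\,dw)} \le C (\alpha/\beta)^{n/(2 s_0 \tilde s)}\, \|\mathcal{A}_w^\beta F\|_{L^2(v\,dw)}$, with $C$ independent of $\alpha$ and $\beta$. -/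

import Mathlib

open MeasureTheory Metric ENNReal NNReal Set

noncomputable section

/-- `w ∈ RH_{s'}` with constant at most `C`, where `1 ≤ s < ∞` and `s' = s/(s-1)`
(with `s' = ∞`, i.e. the `RH_∞` condition, when `s = 1`); Lebesgue measure. -/
def rhConjBound (n : ℕ) (w : EuclideanSpace ℝ (Fin n) → ℝ≥0∞) (s : ℝ) (C : ℝ≥0∞) : Prop :=
  ∀ (c : EuclideanSpace ℝ (Fin n)) (r : ℝ), 0 < r →
    (if s = 1 then essSup w (volume.restrict (ball c r))
      else ((∫⁻ x in ball c r, (w x) ^ (s/(s-1))) / volume (ball c r)) ^ ((s-1)/s))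
      ≤ C * ((∫⁻ x in ball c r, w x) / volume (ball c r))

/-- `v ∈ RH_{s₀'}(w)` with constant at most `C`, where `1 ≤ s₀ < ∞` and `s₀' = s₀/(s₀-1)`
(with `s₀' = ∞` when `s₀ = 1`); averages with respect to the measure `dw = w dx`. -/
def rhConjBoundW (n : ℕ) (w v : EuclideanSpace ℝ (Fin n) → ℝ≥0∞) (s0 : ℝ) (C : ℝ≥0∞) : Prop :=
  ∀ (c : EuclideanSpace ℝ (Fin n)) (r : ℝ), 0 < r →
    (if s0 = 1 then essSup v ((volume.withDensity w).restrict (ball c r))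
      else ((∫⁻ x in ball c r, (v x) ^ (s0/(s0-1)) * w x) /
              (∫⁻ x in ball c r, w x)) ^ ((s0-1)/s0))
      ≤ C * ((∫⁻ x in ball c r, v x * w x) / (∫⁻ x in ball c r, w x))

/-- The square of the conical square function of aperture `γ`. -/
def coneSq (n : ℕ) (w : EuclideanSpace ℝ (Fin n) → ℝ≥0∞) (γ : ℝ)
    (F : EuclideanSpace ℝ (Fin n) → ℝ → ℂ) (x : EuclideanSpace ℝ (Fin n)) : ℝ≥0∞ :=
  ∫⁻ t in Ioi (0:ℝ),
    (∫⁻ y in ball x (γ * t),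
      (‖F y t‖₊ : ℝ≥0∞) ^ 2 * w y / (∫⁻ z in ball y t, w z)) / ENNReal.ofReal t

/-- The reverse Hölder condition with exponent `s' = s / (s - 1)` controls the mass of subsets. -/
theorem setLIntegral_le_of_rh {X : Type*} [MeasurableSpace X] {μ : Measure X}
    {f : X → ℝ≥0∞} (hf : Measurable f) {s : ℝ} (hs : 1 ≤ s) {C : ℝ≥0∞} {A B : Set X}
    (hA : MeasurableSet A) (hAB : A ⊆ B) (hB0 : μ B ≠ 0) (hB : μ B ≠ ∞)
    (h : (if s = 1 then essSup f (μ.restrict B)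
      else ((∫⁻ x in B, f x ^ (s / (s - 1)) ∂μ) / μ B) ^ ((s - 1) / s))
      ≤ C * ((∫⁻ x in B, f x ∂μ) / μ B)) :
    ∫⁻ x in A, f x ∂μ ≤ C * (μ A / μ B) ^ (1 / s) * ∫⁻ x in B, f x ∂μ := by
  have hs0 : 0 < s := by linarith
  split_ifs at h with h1
  · subst h1
    have hae : ∀ᵐ x ∂(μ.restrict A), f x ≤ C * ((∫⁻ x in B, f x ∂μ) / μ B) :=
      (ae_restrict_of_ae_restrict_of_subset hAB (ENNReal.ae_le_essSup f)).mono
        fun x hx => hx.trans h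
    calc ∫⁻ x in A, f x ∂μ ≤ ∫⁻ _ in A, C * ((∫⁻ x in B, f x ∂μ) / μ B) ∂μ :=
          lintegral_mono_ae hae
      _ = C * (μ A / μ B) ^ (1 / (1 : ℝ)) * ∫⁻ x in B, f x ∂μ := by
          rw [setLIntegral_const, one_div_one, ENNReal.rpow_one]
          simp only [div_eq_mul_inv]
          ring
  · have hs1 : 1 < s := lt_of_le_of_ne hs (Ne.symm h1)
    have hpos : 0 < (s - 1) / s := div_pos (by linarith) hs0
    have hpq : (s / (s - 1)).HolderConjugate s :=
      (Real.HolderConjugate.conjExponent hs1).symm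
    have hholder := ENNReal.lintegral_mul_le_Lp_mul_Lq (μ.restrict B) hpq
      (f := f) (g := A.indicator 1) hf.aemeasurable
      ((measurable_one.indicator hA).aemeasurable)
    have hleft : ∫⁻ x in B, (f * A.indicator (1 : X → ℝ≥0∞)) x ∂μ = ∫⁻ x in A, f x ∂μ := by
      have : f * A.indicator (1 : X → ℝ≥0∞) = A.indicator f := by
        ext x; by_cases hx : x ∈ A <;> simp [hx]
      rw [this, lintegral_indicator hA, Measure.restrict_restrict hA, inter_eq_left.2 hAB]
    have hright : ∫⁻ x in B, (A.indicator 1 x : ℝ≥0∞) ^ s ∂μ = μ A := by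
      have : (fun x => (A.indicator 1 x : ℝ≥0∞) ^ s) = A.indicator 1 := by
        ext x; by_cases hx : x ∈ A <;> simp [hx, hs0]
      rw [this, lintegral_indicator_one hA, Measure.restrict_apply hA, inter_eq_left.2 hAB]
    rw [hleft, hright, one_div_div] at hholder
    have hexp : (μ B)⁻¹ * μ B ^ ((s - 1) / s) = (μ B ^ (1 / s))⁻¹ := by
      rw [← ENNReal.rpow_neg_one, ← ENNReal.rpow_add _ _ hB0 hB, ← ENNReal.rpow_neg]
      congr 1
      field_simp
      ring
    calc ∫⁻ x in A, f x ∂μ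
        ≤ (∫⁻ x in B, f x ^ (s / (s - 1)) ∂μ) ^ ((s - 1) / s) * μ A ^ (1 / s) := hholder
      _ = ((∫⁻ x in B, f x ^ (s / (s - 1)) ∂μ) / μ B) ^ ((s - 1) / s) * μ B ^ ((s - 1) / s) *
            μ A ^ (1 / s) := by
          rw [← ENNReal.mul_rpow_of_nonneg _ _ hpos.le, ENNReal.div_mul_cancel hB0 hB]
      _ ≤ (C * ((∫⁻ x in B, f x ∂μ) / μ B)) * μ B ^ ((s - 1) / s) * μ A ^ (1 / s) := by
          gcongr
      _ = C * (∫⁻ x in B, f x ∂μ) * ((μ B)⁻¹ * μ B ^ ((s - 1) / s)) * μ A ^ (1 / s) := by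
          rw [div_eq_mul_inv]; ring
      _ = C * (μ A / μ B) ^ (1 / s) * ∫⁻ x in B, f x ∂μ := by
          rw [hexp, ENNReal.div_rpow_of_nonneg _ _ (by positivity)]
          simp only [div_eq_mul_inv]
          ring

/-- The weight `v w` of a ball of radius `r` is at most a power of `r / R` times the weight of the
concentric ball of radius `R`. -/
theorem setLIntegral_ball_le_of_rh {n : ℕ} {st s0 : ℝ} (hst : 1 ≤ st) (hs0 : 1 ≤ s0)
    {Cw Cv : ℝ≥0∞} {w v : EuclideanSpace ℝ (Fin n) → ℝ≥0∞} (hw : Measurable w)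
    (hv : Measurable v)
    (hfin : ∀ (c : EuclideanSpace ℝ (Fin n)) (r : ℝ), 0 < r →
      0 < (∫⁻ x in ball c r, w x) ∧ (∫⁻ x in ball c r, w x) ≠ ∞)
    (hRw : rhConjBound n w st Cw) (hRv : rhConjBoundW n w v s0 Cv)
    (c : EuclideanSpace ℝ (Fin n)) {r R : ℝ} (hr : 0 < r) (hrR : r ≤ R) :
    ∫⁻ x in ball c r, v x * w x ≤
      Cv * Cw ^ (1 / s0) * ENNReal.ofReal (r / R) ^ ((n : ℝ) / (s0 * st)) *
        ∫⁻ x in ball c R, v x * w x := by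
  have hR : 0 < R := hr.trans_le hrR
  have hs0' : 0 < s0 := by linarith
  have hst' : 0 < st := by linarith
  have hsub : ball c r ⊆ ball c R := ball_subset_ball hrR
  have hvol : volume (ball c r) / volume (ball c R) = ENNReal.ofReal (r / R) ^ (n : ℝ) := by
    rw [Measure.addHaar_ball_of_pos _ _ hr, Measure.addHaar_ball_of_pos _ _ hR,
      ENNReal.mul_div_mul_right _ _ (measure_ball_pos _ _ one_pos).ne' measure_ball_lt_top.ne,
      finrank_euclideanSpace_fin, ← ENNReal.ofReal_div_of_pos (pow_pos hR n), ← div_pow,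
      ENNReal.rpow_natCast, ENNReal.ofReal_pow (div_nonneg hr.le hR.le)]
  have h1 := setLIntegral_le_of_rh hw hst measurableSet_ball hsub
    (measure_ball_pos _ c hR).ne' measure_ball_lt_top.ne (hRw c R hR)
  rw [hvol, ← ENNReal.rpow_mul] at h1
  have hd : ∀ ρ : ℝ, volume.withDensity w (ball c ρ) = ∫⁻ x in ball c ρ, w x := fun ρ =>
    withDensity_apply _ measurableSet_ball
  have hint : ∀ (ρ : ℝ) (f : EuclideanSpace ℝ (Fin n) → ℝ≥0∞), Measurable f →
      ∫⁻ x in ball c ρ, f x ∂(volume.withDensity w) = ∫⁻ x in ball c ρ, f x * w x := by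
    intro ρ f hf
    rw [setLIntegral_withDensity_eq_setLIntegral_mul _ hw hf measurableSet_ball]
    simp only [Pi.mul_apply, mul_comm]
  have h2 := setLIntegral_le_of_rh (μ := volume.withDensity w) (C := Cv) hv hs0
    measurableSet_ball hsub (by rw [hd]; exact (hfin c R hR).1.ne')
    (by rw [hd]; exact (hfin c R hR).2)
    (by rw [hd, hint R _ hv, hint R _ (hv.pow_const _)]; exact hRv c R hR)
  rw [hd, hd, hint r _ hv, hint R _ hv] at h2
  refine h2.trans ?_
  have h3 : (∫⁻ x in ball c r, w x) / (∫⁻ x in ball c R, w x) ≤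
      Cw * ENNReal.ofReal (r / R) ^ ((n : ℝ) * (1 / st)) := ENNReal.div_le_of_le_mul h1
  have h4 := ENNReal.rpow_le_rpow h3 (by positivity : 0 ≤ 1 / s0)
  rw [ENNReal.mul_rpow_of_nonneg _ _ (by positivity), ← ENNReal.rpow_mul,
    show (n : ℝ) * (1 / st) * (1 / s0) = n / (s0 * st) by field_simp] at h4
  calc _ ≤ Cv * (Cw ^ (1 / s0) * ENNReal.ofReal (r / R) ^ ((n : ℝ) / (s0 * st))) *
        ∫⁻ x in ball c R, v x * w x := by gcongr
    _ = _ := by ring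

/-- Lower integrals are superadditive, so no measurability is needed. -/
theorem sum_lintegral_le {X ι : Type*} [MeasurableSpace X] (μ : Measure X) (s : Finset ι)
    (f : ι → X → ℝ≥0∞) : ∑ i ∈ s, ∫⁻ x, f i x ∂μ ≤ ∫⁻ x, ∑ i ∈ s, f i x ∂μ := by
  classical
  induction s using Finset.induction_on with
  | empty => simp
  | insert i s hi ih =>
    simp only [Finset.sum_insert hi]
    exact (add_le_add le_rfl ih).trans (le_lintegral_add _ _)

/-- If the sets `A i` lie in `B` and overlap at most `N` times, then their integrals add up to at
most `N` times the integral over `B`, for arbitrary functions. -/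
theorem sum_setLIntegral_le {X ι : Type*} [MeasurableSpace X] {μ : Measure X} {s : Finset ι}
    {A : ι → Set X} {B : Set X} (hA : ∀ i, MeasurableSet (A i)) (hB : MeasurableSet B) {N : ℕ}
    (hAB : ∀ i ∈ s, A i ⊆ B)
    (hN : ∀ (y : X) (s' : Finset ι), (∀ i ∈ s', y ∈ A i) → s'.card ≤ N) (f : X → ℝ≥0∞) :
    ∑ i ∈ s, ∫⁻ x in A i, f x ∂μ ≤ N * ∫⁻ x in B, f x ∂μ := by
  classical
  simp only [← lintegral_indicator (hA _), ← lintegral_indicator hB]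
  rw [← lintegral_const_mul' _ _ (ENNReal.natCast_ne_top N)]
  refine (sum_lintegral_le _ _ _).trans (lintegral_mono fun y => ?_)
  simp only [indicator_apply, ← Finset.sum_filter, Finset.sum_const, nsmul_eq_mul]
  by_cases hy : y ∈ B
  · rw [if_pos hy]
    gcongr
    exact hN y _ fun i hi => (Finset.mem_filter.1 hi).2
  · have : s.filter (fun i => y ∈ A i) = ∅ :=
      Finset.filter_eq_empty_iff.2 fun i hi h => hy (hAB i hi h)
    simp [this]

theorem setLIntegral_Ioi_eq_tsum (f : ℝ → ℝ≥0∞) :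
    ∫⁻ t in Ioi (0 : ℝ), f t = ∑' k : ℤ, ∫⁻ t in Ico ((2 : ℝ) ^ k) (2 ^ (k + 1)), f t := by
  rw [← lintegral_iUnion (fun _ => measurableSet_Ico)]
  · congr 2
    ext t
    simp only [mem_Ioi, mem_iUnion]
    refine ⟨fun ht => exists_mem_Ico_zpow ht one_lt_two, ?_⟩
    rintro ⟨k, hk⟩
    exact (zpow_pos two_pos k).trans_le hk.1
  · intro i j hij
    refine Set.disjoint_left.2 fun t hi hj => hij ?_
    have h1 := (zpow_lt_zpow_iff_right₀ (one_lt_two (α := ℝ))).1 (hi.1.trans_lt hj.2)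
    have h2 := (zpow_lt_zpow_iff_right₀ (one_lt_two (α := ℝ))).1 (hj.1.trans_lt hi.2)
    omega

/-- The part of the cone integral at heights between `2 ^ k` and `2 ^ (k + 1)`, with the cone
replaced by a general family of sections. -/
def slabIntegral {n : ℕ} (g : EuclideanSpace ℝ (Fin n) → ℝ → ℝ≥0∞) (k : ℤ)
    (A : ℝ → Set (EuclideanSpace ℝ (Fin n))) : ℝ≥0∞ :=
  ∫⁻ t in Ico ((2 : ℝ) ^ k) (2 ^ (k + 1)), (∫⁻ y in A t, g y t) / ENNReal.ofReal t

theorem slabIntegral_mono {n : ℕ} (g : EuclideanSpace ℝ (Fin n) → ℝ → ℝ≥0∞) (k : ℤ)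
    {A B : ℝ → Set (EuclideanSpace ℝ (Fin n))}
    (h : ∀ t ∈ Ico ((2 : ℝ) ^ k) (2 ^ (k + 1)), A t ⊆ B t) :
    slabIntegral g k A ≤ slabIntegral g k B :=
  setLIntegral_mono' measurableSet_Ico fun t ht =>
    ENNReal.div_le_div_right (lintegral_mono_set (h t ht)) _

theorem sum_slabIntegral_le {n : ℕ} {ι : Type*} (g : EuclideanSpace ℝ (Fin n) → ℝ → ℝ≥0∞) (k : ℤ)
    {s : Finset ι} {A : ι → Set (EuclideanSpace ℝ (Fin n))}
    {B : ℝ → Set (EuclideanSpace ℝ (Fin n))} (hA : ∀ i, MeasurableSet (A i))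
    (hB : ∀ t, MeasurableSet (B t)) {N : ℕ}
    (hAB : ∀ t ∈ Ico ((2 : ℝ) ^ k) (2 ^ (k + 1)), ∀ i ∈ s, A i ⊆ B t)
    (hN : ∀ (y : EuclideanSpace ℝ (Fin n)) (s' : Finset ι), (∀ i ∈ s', y ∈ A i) → s'.card ≤ N) :
    ∑ i ∈ s, slabIntegral g k (fun _ => A i) ≤ N * slabIntegral g k B := by
  unfold slabIntegral
  rw [← lintegral_const_mul' _ _ (ENNReal.natCast_ne_top N)]
  refine (sum_lintegral_le _ _ _).trans (setLIntegral_mono' measurableSet_Ico fun t ht => ?_)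
  simp only [div_eq_mul_inv]
  rw [← Finset.sum_mul, ← mul_assoc]
  gcongr
  exact sum_setLIntegral_le hA (hB t) (hAB t ht) hN _

/-- The lattice point with index `i` in the lattice of mesh `δ`. -/
def gridPoint {n : ℕ} (δ : ℝ) (i : Fin n → ℤ) : EuclideanSpace ℝ (Fin n) :=
  WithLp.toLp 2 fun j => δ * i j

/-- The index of the half-open cube of side `δ` containing `x`. -/
def gridIndex {n : ℕ} (δ : ℝ) (x : EuclideanSpace ℝ (Fin n)) : Fin n → ℤ :=
  fun j => ⌊x j / δ⌋

theorem measurable_gridIndex {n : ℕ} (δ : ℝ) :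
    Measurable (gridIndex δ : EuclideanSpace ℝ (Fin n) → Fin n → ℤ) := by
  refine measurable_pi_lambda _ fun j => Int.measurable_floor.comp ?_
  fun_prop

theorem EuclideanSpace.norm_lt_of_forall_abs_le {n : ℕ} {x : EuclideanSpace ℝ (Fin n)} {δ : ℝ}
    (hδ : 0 < δ) (h : ∀ j, |x j| ≤ δ) : ‖x‖ < (n + 1) * δ := by
  rw [EuclideanSpace.norm_eq, Real.sqrt_lt' (by positivity)]
  calc ∑ j, ‖x j‖ ^ 2 ≤ ∑ _j : Fin n, δ ^ 2 := by
        gcongr with j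
        exact h j
    _ = n * δ ^ 2 := by simp
    _ < ((n + 1) * δ) ^ 2 := by
        have : 0 < (n ^ 2 + n + 1 : ℝ) * δ ^ 2 := by positivity
        linarith

theorem dist_gridPoint_gridIndex_lt {n : ℕ} {δ : ℝ} (hδ : 0 < δ)
    (x : EuclideanSpace ℝ (Fin n)) : dist x (gridPoint δ (gridIndex δ x)) < (n + 1) * δ := by
  rw [dist_eq_norm]
  refine EuclideanSpace.norm_lt_of_forall_abs_le hδ fun j => ?_
  have h1 := Int.floor_le (x j / δ)
  have h2 := Int.lt_floor_add_one (x j / δ)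
  rw [le_div_iff₀ hδ] at h1
  rw [div_lt_iff₀ hδ] at h2
  simp only [gridPoint, gridIndex, PiLp.sub_apply]
  rw [abs_le]
  constructor <;> linarith

theorem card_le_of_mem_ball_gridPoint {n : ℕ} {δ : ℝ} (hδ : 0 < δ) (M : ℕ)
    (y : EuclideanSpace ℝ (Fin n)) (s : Finset (Fin n → ℤ))
    (h : ∀ i ∈ s, y ∈ ball (gridPoint δ i) (M * δ)) : s.card ≤ (2 * M + 2) ^ n := by
  classical
  have hsub : s ⊆ Fintype.piFinset fun j =>
      Finset.Icc (⌊y j / δ⌋ - M) (⌊y j / δ⌋ + M + 1) := by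
    intro i hi
    rw [Fintype.mem_piFinset]
    intro j
    have h1 : |y j - δ * i j| < M * δ := by
      have := (PiLp.norm_apply_le (y - gridPoint δ i) j).trans_lt (mem_ball_iff_norm.1 (h i hi))
      simpa [gridPoint] using this
    rw [abs_lt] at h1
    have h2 := Int.floor_le (y j / δ)
    have h3 := Int.lt_floor_add_one (y j / δ)
    have h4 : y j / δ < i j + M := by rw [div_lt_iff₀ hδ]; linarith
    have h5 : (i j : ℝ) - M < y j / δ := by rw [lt_div_iff₀ hδ]; linarith
    rw [Finset.mem_Icc]
    constructor
    · have : ((⌊y j / δ⌋ - M : ℤ) : ℝ) < (i j : ℝ) := by push_cast; linarith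
      exact (Int.cast_lt.1 this).le
    · have : ((i j : ℤ) : ℝ) < ((⌊y j / δ⌋ + M + 1 : ℤ) : ℝ) := by push_cast; linarith
      exact (Int.cast_lt.1 this).le
  refine (Finset.card_le_card hsub).trans ?_
  rw [Fintype.card_piFinset]
  simp only [Int.card_Icc]
  refine (Finset.prod_le_pow_card _ _ (2 * M + 2) fun j _ => ?_).trans (by simp)
  omega

/-- Change of aperture for the weight `u`, when the weight of a ball is controlled by the weight of
the concentric larger ball. The integrand `g` may be non-measurable, hence the discretization in
place of Tonelli's theorem. -/
theorem lintegral_tsum_slabIntegral_le {n : ℕ} (g : EuclideanSpace ℝ (Fin n) → ℝ → ℝ≥0∞)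
    {u : EuclideanSpace ℝ (Fin n) → ℝ≥0∞} (hu : Measurable u) {D : ℝ≥0∞} {α β : ℝ} (hα : 0 < α)
    (hαβ : 6 * α ≤ β)
    (hD : ∀ (c : EuclideanSpace ℝ (Fin n)) (ρ : ℝ), 0 < ρ →
      ∫⁻ x in ball c (α * ρ), u x ≤ D * ∫⁻ x in ball c (β / 2 * ρ), u x) :
    ∫⁻ x, (∑' k : ℤ, slabIntegral g k (fun t => ball x (α * t))) * u x ≤
      D * ((2 * (3 * (n + 1)) + 2) ^ n : ℕ) *
        ∫⁻ x, (∑' k : ℤ, slabIntegral g k (fun t => ball x (β * t))) * u x := by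
  classical
  set N : ℕ := (2 * (3 * (n + 1)) + 2) ^ n with hNdef
  set τ : ℤ → ℝ := fun k => (2 : ℝ) ^ k with hτdef
  have hτ : ∀ k, 0 < τ k := fun k => zpow_pos two_pos k
  have hτ' : ∀ k, (2 : ℝ) ^ (k + 1) = 2 * τ k := fun k => by
    rw [zpow_add_one₀ two_ne_zero, mul_comm]
  set δ : ℤ → ℝ := fun k => α * τ k / (n + 1) with hδdef
  have hδ : ∀ k, 0 < δ k := fun k => div_pos (mul_pos hα (hτ k)) (by positivity)
  have hδτ : ∀ k, (n + 1) * δ k = α * τ k := fun k => by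
    simp only [hδdef]; field_simp
  set L : ℤ → (Fin n → ℤ) → ℝ≥0∞ := fun k i =>
    slabIntegral g k (fun _ => ball (gridPoint (δ k) i) (3 * (α * τ k))) with hL
  set Q : ℤ → (Fin n → ℤ) → Set (EuclideanSpace ℝ (Fin n)) := fun k i =>
    gridIndex (δ k) ⁻¹' {i} with hQ
  have hQm : ∀ k i, MeasurableSet (Q k i) := fun k i =>
    measurable_gridIndex _ (measurableSet_singleton i)
  have hQball : ∀ k i, Q k i ⊆ ball (gridPoint (δ k) i) (α * τ k) := by
    intro k i x hx
    have : gridIndex (δ k) x = i := hx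
    rw [mem_ball, ← hδτ, ← this]
    exact dist_gridPoint_gridIndex_lt (hδ k) x
  have hupper : ∀ x, ∑' k : ℤ, slabIntegral g k (fun t => ball x (α * t)) ≤
      ∑' k, ∑' i, (Q k i).indicator (fun _ => L k i) x := by
    intro x
    refine ENNReal.tsum_le_tsum fun k => ?_
    refine le_trans ?_ (ENNReal.le_tsum (gridIndex (δ k) x))
    rw [indicator_of_mem (show x ∈ Q k (gridIndex (δ k) x) from rfl)]
    refine slabIntegral_mono g k fun t ht => ball_subset_ball' ?_
    have h1 := hQball k _ (show x ∈ Q k (gridIndex (δ k) x) from rfl)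
    rw [mem_ball] at h1
    have h2 : α * t ≤ α * (2 * τ k) := by
      rw [← hτ']; exact mul_le_mul_of_nonneg_left ht.2.le hα.le
    linarith
  have hlower : ∀ x, ∑' k, ∑' i, (ball (gridPoint (δ k) i) (β / 2 * τ k)).indicator
      (fun _ => L k i) x ≤ N * ∑' k : ℤ, slabIntegral g k (fun t => ball x (β * t)) := by
    intro x
    rw [← ENNReal.tsum_mul_left]
    refine ENNReal.tsum_le_tsum fun k => ?_
    rw [ENNReal.tsum_eq_iSup_sum]
    refine iSup_le fun s => ?_
    simp only [indicator_apply, ← Finset.sum_filter]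
    refine sum_slabIntegral_le g k (fun _ => measurableSet_ball) (fun _ => measurableSet_ball)
      ?_ ?_
    · intro t ht i hi
      have h1 := (Finset.mem_filter.1 hi).2
      rw [mem_ball, dist_comm] at h1
      refine ball_subset_ball' ?_
      have h2 : β * τ k ≤ β * t := mul_le_mul_of_nonneg_left ht.1 (by linarith)
      have h3 : 6 * α * τ k ≤ β * τ k := mul_le_mul_of_nonneg_right hαβ (hτ k).le
      linarith
    · intro y s' hs'
      refine card_le_of_mem_ball_gridPoint (hδ k) (3 * (n + 1)) y s' fun i hi => ?_
      convert hs' i hi using 2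
      push_cast
      rw [← hδτ]
      ring
  have hint : ∀ S : ℤ → (Fin n → ℤ) → Set (EuclideanSpace ℝ (Fin n)),
      (∀ k i, MeasurableSet (S k i)) →
      ∫⁻ x, (∑' k, ∑' i, (S k i).indicator (fun _ => L k i) x) * u x =
        ∑' k, ∑' i, L k i * ∫⁻ x in S k i, u x := by
    intro S hS
    have hm : ∀ k i, Measurable fun x => (S k i).indicator (fun _ => L k i) x * u x :=
      fun k i => (measurable_const.indicator (hS k i)).mul hu
    simp only [← ENNReal.tsum_mul_right]
    rw [lintegral_tsum fun k => (Measurable.tsum (hm k)).aemeasurable]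
    refine tsum_congr fun k => ?_
    rw [lintegral_tsum fun i => (hm k i).aemeasurable]
    refine tsum_congr fun i => ?_
    rw [← lintegral_const_mul _ hu, ← lintegral_indicator (hS k i)]
    refine lintegral_congr fun x => ?_
    by_cases hx : x ∈ S k i <;> simp [hx]
  calc ∫⁻ x, (∑' k : ℤ, slabIntegral g k (fun t => ball x (α * t))) * u x
      ≤ ∫⁻ x, (∑' k, ∑' i, (Q k i).indicator (fun _ => L k i) x) * u x :=
        lintegral_mono fun x => mul_le_mul_left (hupper x) _
    _ = ∑' k, ∑' i, L k i * ∫⁻ x in Q k i, u x := hint Q hQm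
    _ ≤ ∑' k, ∑' i, D * (L k i * ∫⁻ x in ball (gridPoint (δ k) i) (β / 2 * τ k), u x) := by
        refine ENNReal.tsum_le_tsum fun k => ENNReal.tsum_le_tsum fun i => ?_
        rw [mul_left_comm]
        gcongr
        exact (lintegral_mono_set (hQball k i)).trans (hD _ _ (hτ k))
    _ = D * ∫⁻ x, (∑' k, ∑' i, (ball (gridPoint (δ k) i) (β / 2 * τ k)).indicator
          (fun _ => L k i) x) * u x := by
        rw [hint _ fun _ _ => measurableSet_ball]
        simp only [ENNReal.tsum_mul_left]
    _ ≤ D * ∫⁻ x, N * ((∑' k : ℤ, slabIntegral g k (fun t => ball x (β * t))) * u x) := by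
        refine mul_le_mul_right (lintegral_mono fun x => ?_) _
        rw [← mul_assoc]
        exact mul_le_mul_left (hlower x) _
    _ = _ := by rw [lintegral_const_mul' _ _ (ENNReal.natCast_ne_top N), mul_assoc]

theorem coneSq_eq_tsum (n : ℕ) (w : EuclideanSpace ℝ (Fin n) → ℝ≥0∞) (γ : ℝ)
    (F : EuclideanSpace ℝ (Fin n) → ℝ → ℂ) (x : EuclideanSpace ℝ (Fin n)) :
    coneSq n w γ F x = ∑' k : ℤ, slabIntegral
      (fun y t => (‖F y t‖₊ : ℝ≥0∞) ^ 2 * w y / (∫⁻ z in ball y t, w z)) k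
      (fun t => ball x (γ * t)) :=
  setLIntegral_Ioi_eq_tsum _

theorem coneSq_mono (n : ℕ) (w : EuclideanSpace ℝ (Fin n) → ℝ≥0∞) {α β : ℝ} (h : α ≤ β)
    (F : EuclideanSpace ℝ (Fin n) → ℝ → ℂ) (x : EuclideanSpace ℝ (Fin n)) :
    coneSq n w α F x ≤ coneSq n w β F x :=
  setLIntegral_mono' measurableSet_Ioi fun _ ht => ENNReal.div_le_div_right
    (lintegral_mono_set (ball_subset_ball (mul_le_mul_of_nonneg_right h (le_of_lt ht)))) _

/-- change of angles in `L²(v dw)` for `w ∈ RH_{s̃'}` and `v ∈ RH_{s₀'}(w)`: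
`‖𝒜_w^α F‖_{L²(v dw)} ≤ C (α/β)^(n/(2 s₀ s̃)) ‖𝒜_w^β F‖_{L²(v dw)}`, with `C` independent
of `α` and `β`. -/
theorem change_of_angle_L2_RH
    (n : ℕ) (st s0 : ℝ) (hst : 1 ≤ st) (hs0 : 1 ≤ s0) (Cw Cv : ℝ≥0) :
    ∃ C : ℝ≥0, ∀ (w v : EuclideanSpace ℝ (Fin n) → ℝ≥0∞)
      (F : EuclideanSpace ℝ (Fin n) → ℝ → ℂ) (α β : ℝ),
      Measurable w → Measurable v →
      (∀ (c : EuclideanSpace ℝ (Fin n)) (r : ℝ), 0 < r →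
        0 < (∫⁻ x in ball c r, w x) ∧ (∫⁻ x in ball c r, w x) ≠ ∞) →
      rhConjBound n w st Cw → rhConjBoundW n w v s0 Cv →
      0 < α → α ≤ β →
      (∫⁻ x, coneSq n w α F x * (v x * w x)) ^ ((1:ℝ)/2) ≤
        C * ENNReal.ofReal (α/β) ^ ((n : ℝ) / (2 * s0 * st)) *
          (∫⁻ x, coneSq n w β F x * (v x * w x)) ^ ((1:ℝ)/2) := by
  have hst' : 0 < st := by linarith
  have hs0' : 0 < s0 := by linarith
  set θ : ℝ := (n : ℝ) / (s0 * st) with hθ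
  have hθ0 : 0 ≤ θ := by positivity
  set N : ℕ := (2 * (3 * (n + 1)) + 2) ^ n with hN
  set K : ℝ≥0 := Cv * Cw ^ (1 / s0) * 2 ^ θ * N + 6 ^ θ with hK
  have hKcoe : (K : ℝ≥0∞) = Cv * (Cw : ℝ≥0∞) ^ (1 / s0) * 2 ^ θ * N + 6 ^ θ := by
    rw [hK]
    push_cast
    rw [ENNReal.coe_rpow_of_nonneg _ (by positivity), ENNReal.coe_rpow_of_nonneg _ hθ0,
      ENNReal.coe_rpow_of_nonneg _ hθ0]
    rfl
  refine ⟨K ^ ((1 : ℝ) / 2), fun w v F α β hw hv hfin hRw hRv hα hαβ => ?_⟩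
  have hβ : 0 < β := hα.trans_le hαβ
  suffices h : ∫⁻ x, coneSq n w α F x * (v x * w x) ≤
      K * ENNReal.ofReal (α / β) ^ θ * ∫⁻ x, coneSq n w β F x * (v x * w x) by
    refine (ENNReal.rpow_le_rpow h (by norm_num : (0 : ℝ) ≤ 1 / 2)).trans_eq ?_
    rw [ENNReal.mul_rpow_of_nonneg _ _ (by norm_num), ENNReal.mul_rpow_of_nonneg _ _ (by norm_num),
      ← ENNReal.rpow_mul, ENNReal.coe_rpow_of_nonneg _ (by norm_num),
      show θ * (1 / 2) = (n : ℝ) / (2 * s0 * st) by rw [hθ]; field_simp]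
  rcases le_or_gt (6 * α) β with h6 | h6
  · have hmain := lintegral_tsum_slabIntegral_le
      (fun y t => (‖F y t‖₊ : ℝ≥0∞) ^ 2 * w y / (∫⁻ z in ball y t, w z)) (hv.mul hw)
      (D := Cv * (Cw : ℝ≥0∞) ^ (1 / s0) * (2 ^ θ * ENNReal.ofReal (α / β) ^ θ)) hα h6 (by
        intro c ρ hρ
        refine (setLIntegral_ball_le_of_rh hst hs0 hw hv hfin hRw hRv c (mul_pos hα hρ)
          (R := β / 2 * ρ) (mul_le_mul_of_nonneg_right (by linarith) hρ.le)).trans_eq ?_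
        have hratio : ENNReal.ofReal (α * ρ / (β / 2 * ρ)) = 2 * ENNReal.ofReal (α / β) := by
          rw [show α * ρ / (β / 2 * ρ) = 2 * (α / β) by field_simp,
            ENNReal.ofReal_mul zero_le_two, ENNReal.ofReal_ofNat]
        rw [hratio, ENNReal.mul_rpow_of_nonneg _ _ hθ0]
        rfl)
    simp only [coneSq_eq_tsum]
    refine hmain.trans ?_
    rw [hKcoe]
    refine mul_le_mul_left ?_ _
    rw [add_mul]
    refine le_trans (le_of_eq ?_) le_self_add
    ring
  · have hone : 1 ≤ (K : ℝ≥0∞) * ENNReal.ofReal (α / β) ^ θ := by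
      calc (1 : ℝ≥0∞) ≤ ENNReal.ofReal (6 * (α / β)) ^ θ := by
            refine (ENNReal.one_rpow θ).symm.le.trans (ENNReal.rpow_le_rpow ?_ hθ0)
            rw [ENNReal.one_le_ofReal, mul_div_assoc', one_le_div hβ]
            exact h6.le
        _ = 6 ^ θ * ENNReal.ofReal (α / β) ^ θ := by
            rw [ENNReal.ofReal_mul (by norm_num), ENNReal.mul_rpow_of_nonneg _ _ hθ0,
              ENNReal.ofReal_ofNat]
        _ ≤ K * ENNReal.ofReal (α / β) ^ θ := by
            rw [hKcoe]
            gcongr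
            exact le_add_self
    calc ∫⁻ x, coneSq n w α F x * (v x * w x)
        ≤ ∫⁻ x, coneSq n w β F x * (v x * w x) :=
          lintegral_mono fun x => mul_le_mul_left (coneSq_mono n w hαβ F x) _
      _ ≤ _ := le_mul_of_one_le_left zero_le hone
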